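/- For every prime p ≥ 5: deg ss_p^{(2)}(X) − L^{(2)}(p) ≤ 2 if and only if p divides #𝔹 (the order of the Baby monster group), and deg ss_p^{(2)}(X) − L^{(2)}(p) ≤ 6 if and only if p divides #𝕄 (the order of the Monster group). -/

import Mathlib

open Polynomial

noncomputable section

/-- The class number h(√-d) of the imaginary quadratic field ℚ(√-d),
realized as the subfield of ℂ generated by i·√d. -/
def classNumberSqrtNeg (d : ℕ) : ℕ :=
  haveI : FiniteDimensional ℚ (IntermediateField.adjoin ℚ {(Complex.I * Real.sqrt d : ℂ)}) :=
    IntermediateField.adjoin.finiteDimensional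
      ⟨X ^ 2 + C (d : ℚ), monic_X_pow_add_C _ (by norm_num), by
        have h : (Complex.I * (Real.sqrt d : ℂ)) ^ 2 = -(d : ℂ) := by
          rw [mul_pow, Complex.I_sq, ← Complex.ofReal_pow, Real.sq_sqrt (Nat.cast_nonneg d)]
          simp
        simp [h]⟩
  haveI : NumberField (IntermediateField.adjoin ℚ {(Complex.I * Real.sqrt d : ℂ)}) := ⟨⟩
  NumberField.classNumber (IntermediateField.adjoin ℚ {(Complex.I * Real.sqrt d : ℂ)})

variable (p : ℕ) [Fact p.Prime]

/-- ε = (1 - (-1|p))/2 -/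
def eps : ℕ := ((1 - legendreSym p (-1)) / 2).toNat
/-- δ = (1 - (-3|p))/2 -/
def del : ℕ := ((1 - legendreSym p (-3)) / 2).toNat
/-- ν = (1 - (-2|p))/2 -/
def nu : ℕ := ((1 - legendreSym p (-2)) / 2).toNat

/-- The Pochhammer symbol (x)_n = x(x+1)⋯(x+n-1) in 𝔽_p. -/
def poch (x : ZMod p) (n : ℕ) : ZMod p := (ascPochhammer (ZMod p) n).eval x

/-- The level-2 supersingular polynomial ss_p^{(2)}(X) ∈ 𝔽_p[X]:
Σ_{n=0}^{m} ((-m)_n (3/4-ε/2)_n / (n!)²) 64^n X^{m+ε-n}, with m = ⌊p/4⌋. -/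
def ss2Poly : (ZMod p)[X] :=
  ∑ n ∈ Finset.range (p / 4 + 1),
    C (poch p (-(p / 4 : ℕ) : ZMod p) n *
       poch p ((3 : ZMod p) / 4 - (eps p : ZMod p) / 2) n /
       ((n.factorial : ZMod p)) ^ 2 * 64 ^ n) *
    X ^ (p / 4 + eps p - n)

/-- L^{(2)}(p): the number of distinct roots of ss_p^{(2)}(X) in 𝔽_p. -/
def L2 : ℕ := (ss2Poly p).roots.toFinset.card

/-- The order of the Monster simple group 𝕄. -/
def monsterOrder : ℕ :=
  2 ^ 46 * 3 ^ 20 * 5 ^ 9 * 7 ^ 6 * 11 ^ 2 * 13 ^ 3 * 17 * 19 * 23 * 29 * 31 * 41 * 47 * 59 * 71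

/-- The order of the Baby monster group 𝔹. -/
def babyMonsterOrder : ℕ :=
  2 ^ 41 * 3 ^ 13 * 5 ^ 6 * 7 ^ 2 * 11 * 13 * 17 * 19 * 23 * 31 * 47

/-- The order of Fischer's sporadic group Fi′₂₄. -/
def fischer24Order : ℕ :=
  2 ^ 21 * 3 ^ 16 * 5 ^ 2 * 7 ^ 3 * 11 * 13 * 17 * 23 * 29

/-- Taylor coefficients, in the ratio of the two solution coordinates, of the initial point of
the hypergeometric flow through a given point; the common denominator is `40320 * v ^ 7`. -/
def flowCoeff {R : Type*} [CommRing R] (v : R) : ℕ → R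
  | 0 =>
      40320 * v ^ 7
  | 1 =>
      -40320 * v ^ 7
  | 2 =>
      20160 * v ^ 7 + 1290240 * v ^ 6
  | 3 =>
      -6720 * v ^ 7 - 1021440 * v ^ 6 - 27525120 * v ^ 5
  | 4 =>
      1680 * v ^ 7 + 443520 * v ^ 6 + 33546240 * v ^ 5 + 440401920 * v ^ 4
  | 5 =>
      -336 * v ^ 7 - 134400 * v ^ 6 - 17676288 * v ^ 5 - 880803840 * v ^ 4 - 5637144576 * v ^ 3
  | 6 =>
      56 * v ^ 7 + 31360 * v ^ 6 + 6336512 * v ^ 5 + 540409856 * v ^ 4 + 19495124992 * v ^ 3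
      + 60129542144 * v ^ 2
  | 7 =>
      -8 * v ^ 7 - 5952 * v ^ 6 - 1680384 * v ^ 5 - 228843520 * v ^ 4 - 14017363968 * v ^ 3
      - 370440929280 * v ^ 2 - 549755813888 * v
  | 8 =>
      1 * v ^ 7 + 952 * v ^ 6 + 357888 * v ^ 5 + 67033088 * v ^ 4 + 6930169856 * v ^ 3
      + 326652395520 * v ^ 2 + 6124623364096 * v + 4398046511104
  | _ => 0

/-- Denominator coefficients of the diagonal Padé approximant of degree 4 to `flowCoeff`. -/
def padeDen {R : Type*} [CommRing R] (v : R) : ℕ → R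
  | 0 =>
      1680 * v ^ 12 + 376320 * v ^ 11 + 643614720 * v ^ 10 - 5033656320 * v ^ 9
      - 3428356915200 * v ^ 8 - 20617856286720 * v ^ 7 + 10798063178219520 * v ^ 6
      + 25860513485291520 * v ^ 5 + 472877960873902080 * v ^ 4
  | 1 =>
      840 * v ^ 12 + 302400 * v ^ 11 + 194019840 * v ^ 10 + 50859970560 * v ^ 9
      - 362423255040 * v ^ 8 - 216837610536960 * v ^ 7 - 3854115746611200 * v ^ 6
      + 508609339997552640 * v ^ 5 + 797981558974709760 * v ^ 4 + 15132094747964866560 * v ^ 3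
  | 2 =>
      180 * v ^ 12 + 84960 * v ^ 11 + 9642240 * v ^ 10 + 13761239040 * v ^ 9
      + 2222341816320 * v ^ 8 + 21157152030720 * v ^ 7 - 5687224565760000 * v ^ 6
      - 168959718457344000 * v ^ 5 + 10005643773691822080 * v ^ 4 + 6890507429876858880 * v ^ 3
      + 207525870829232455680 * v ^ 2
  | 3 =>
      20 * v ^ 12 + 11200 * v ^ 11 - 3381760 * v ^ 10 + 939663360 * v ^ 9 + 542386667520 * v ^ 8
      + 58230563143680 * v ^ 7 + 1425561134039040 * v ^ 6 - 42933717156495360 * v ^ 5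
      - 1885772392798617600 * v ^ 4 + 110236859878961315840 * v ^ 3
      + 63410682753376583680 * v ^ 2 + 1475739525896764129280 * v
  | 4 =>
      1 * v ^ 12 + 624 * v ^ 11 - 459648 * v ^ 10 - 25152512 * v ^ 9 + 39490080768 * v ^ 8
      + 8358786367488 * v ^ 7 + 680830008557568 * v ^ 6 + 24800561995972608 * v ^ 5
      + 337011515188051968 * v ^ 4 + 47991483529166848 * v ^ 3 + 623442303616152502272 * v ^ 2
      + 166020696663385964544 * v + 4722366482869645213696
  | _ => 0

/-- Numerator coefficients of the diagonal Padé approximant of degree 4 to `flowCoeff`. -/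
def padeNum {R : Type*} [CommRing R] (v : R) : ℕ → R
  | 0 =>
      1680 * v ^ 12 + 376320 * v ^ 11 + 643614720 * v ^ 10 - 5033656320 * v ^ 9
      - 3428356915200 * v ^ 8 - 20617856286720 * v ^ 7 + 10798063178219520 * v ^ 6
      + 25860513485291520 * v ^ 5 + 472877960873902080 * v ^ 4
  | 1 =>
      -840 * v ^ 12 - 73920 * v ^ 11 - 449594880 * v ^ 10 + 55893626880 * v ^ 9
      + 3065933660160 * v ^ 8 - 196219754250240 * v ^ 7 - 14652178924830720 * v ^ 6
      + 482748826512261120 * v ^ 5 + 325103598100807680 * v ^ 4 + 15132094747964866560 * v ^ 3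
  | 2 =>
      180 * v ^ 12 + 24480 * v ^ 11 + 149472000 * v ^ 10 - 19019888640 * v ^ 9
      + 709509611520 * v ^ 8 + 117978413137920 * v ^ 7 + 2906151368785920 * v ^ 6
      - 319100780009226240 * v ^ 5 + 10271637626683392000 * v ^ 4 + 6890507429876858880 * v ^ 3
      + 207525870829232455680 * v ^ 2
  | 3 =>
      -20 * v ^ 12 - 960 * v ^ 11 - 24286720 * v ^ 10 + 3094179840 * v ^ 9 + 25890078720 * v ^ 8
      + 10781388963840 * v ^ 7 - 690008893685760 * v ^ 6 - 6786928795975680 * v ^ 5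
      - 3322350305185628160 * v ^ 4 + 106814124162159738880 * v ^ 3
      + 17293822569102704640 * v ^ 2 + 1475739525896764129280 * v
  | 4 =>
      1 * v ^ 12 + 144 * v ^ 11 + 2245632 * v ^ 10 - 172439552 * v ^ 9 + 29513822208 * v ^ 8
      + 6693305253888 * v ^ 7 + 787420799827968 * v ^ 6 + 27415778319925248 * v ^ 5
      + 495159770169212928 * v ^ 4 - 11849955782030262272 * v ^ 3 + 632089214900703854592 * v ^ 2
      + 166020696663385964544 * v + 4722366482869645213696
  | _ => 0

theorem derivative_flowCoeff {K : Type*} [CommRing K] {k : ℕ} (hk : k ≤ 7) :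
    (X - 64 : K[X]) * X * derivative (flowCoeff (X - 64 : K[X]) k) =
      7 * X * flowCoeff (X - 64 : K[X]) k
        - ((k : K[X]) + 1) * (X - 64) * flowCoeff (X - 64 : K[X]) (k + 1)
        - (X - 64) * flowCoeff (X - 64 : K[X]) k - 64 * (k : K[X]) * flowCoeff (X - 64 : K[X]) k
        + 12 * ((k - 1 : ℕ) : K[X]) * flowCoeff (X - 64 : K[X]) (k - 1) := by
  obtain ⟨v, hv⟩ : ∃ v : K[X], v = X - 64 := ⟨_, rfl⟩
  have hX : (X : K[X]) = v + 64 := by rw [hv]; ring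
  have hd : derivative v = 1 := by simp [hv]
  rw [← hv, hX]
  interval_cases k <;>
    simp only [flowCoeff, derivative_add, derivative_sub, derivative_neg, derivative_mul,
      derivative_pow, derivative_ofNat, hd] <;>
    push_cast <;> simp only [map_ofNat] <;> ring

theorem padeNum_eq {R : Type*} [CommRing R] (v : R) {k : ℕ} (hk : k ≤ 4) :
    40320 * v ^ 7 * padeNum v k =
      ∑ j ∈ Finset.range (k + 1), padeDen v j * flowCoeff v (k - j) := by
  interval_cases k <;> simp only [Finset.sum_range_succ, Finset.sum_range_zero] <;>
    norm_num only [padeNum, padeDen, flowCoeff] <;> ring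

theorem sum_padeDen_mul_flowCoeff {R : Type*} [CommRing R] (v : R) {k : ℕ} (hk : k < 4) :
    ∑ j ∈ Finset.range 5, padeDen v j * flowCoeff v (k + 5 - j) = 0 := by
  interval_cases k <;> simp only [Finset.sum_range_succ, Finset.sum_range_zero] <;>
    norm_num only [padeDen, flowCoeff] <;> ring

/-- The degree 8 form vanishing to first order at the rational zeros of `f`. -/
def flowForm {K : Type*} [CommRing K] (p : ℕ) (f g : K[X]) : K[X] :=
  X * ∑ k ∈ Finset.range 9, flowCoeff (X - 64) k * f ^ k * g ^ (8 - k)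
    - 40320 * (X - 64) ^ 7 * X ^ p * g ^ 8

/-- The auxiliary polynomial, vanishing to order 9 at the rational zeros of `f`. -/
def stepanovForm {K : Type*} [CommRing K] (p : ℕ) (f g : K[X]) : K[X] :=
  X * ∑ k ∈ Finset.range 5, padeNum (X - 64) k * f ^ k * g ^ (4 - k)
    - X ^ p * ∑ k ∈ Finset.range 5, padeDen (X - 64) k * f ^ k * g ^ (4 - k)

theorem pow_dvd_derivative_flowForm {p : ℕ} {K : Type*} [CommRing K] [CharP K p] {f g : K[X]}
    {a : K}
    (hf : X * derivative f = g + C a * f)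
    (hg : (X - 64) * (X * derivative g - C a * g) = 12 * f - 64 * g) :
    f ^ 8 ∣ (X - 64) * X * (g * derivative (flowForm p f g) - 8 * derivative g * flowForm p f g)
      - 7 * X * g * flowForm p f g := by
  have h0 := derivative_flowCoeff (K := K) (k := 0) (by norm_num)
  have h1 := derivative_flowCoeff (K := K) (k := 1) (by norm_num)
  have h2 := derivative_flowCoeff (K := K) (k := 2) (by norm_num)
  have h3 := derivative_flowCoeff (K := K) (k := 3) (by norm_num)
  have h4 := derivative_flowCoeff (K := K) (k := 4) (by norm_num)
  have h5 := derivative_flowCoeff (K := K) (k := 5) (by norm_num)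
  have h6 := derivative_flowCoeff (K := K) (k := 6) (by norm_num)
  have h7 := derivative_flowCoeff (K := K) (k := 7) (by norm_num)
  have hp : derivative (X ^ p : K[X]) = 0 := by
    rw [derivative_X_pow, CharP.cast_eq_zero, C_0, zero_mul]
  have hv : derivative ((X : K[X]) - 64) = 1 := by simp
  simp only [flowForm, Finset.sum_range_succ, Finset.sum_range_zero, zero_add]
  norm_num only [pow_zero, mul_one, pow_one] at h0 h1 h2 h3 h4 h5 h6 h7 ⊢
  generalize flowCoeff (X - 64 : K[X]) 0 = c0 at *
  generalize flowCoeff (X - 64 : K[X]) 1 = c1 at *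
  generalize flowCoeff (X - 64 : K[X]) 2 = c2 at *
  generalize flowCoeff (X - 64 : K[X]) 3 = c3 at *
  generalize flowCoeff (X - 64 : K[X]) 4 = c4 at *
  generalize flowCoeff (X - 64 : K[X]) 5 = c5 at *
  generalize flowCoeff (X - 64 : K[X]) 6 = c6 at *
  generalize flowCoeff (X - 64 : K[X]) 7 = c7 at *
  generalize flowCoeff (X - 64 : K[X]) 8 = c8 at *
  have hder : derivative (40320 * (X - 64) ^ 7 * X ^ p * g ^ 8 : K[X]) =
      40320 * X ^ p * (7 * (X - 64) ^ 6 * g ^ 8 + 8 * (X - 64) ^ 7 * g ^ 7 * derivative g) := by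
    rw [derivative_mul, derivative_mul, derivative_mul, hp, derivative_pow, derivative_pow, hv]
    simp only [derivative_ofNat]
    push_cast
    simp only [map_ofNat]
    ring
  refine ⟨X * (g * ((X - 64) * c8 + (X - 64) * X * derivative c8 - 7 * X * c8
    + 512 * c8 - 84 * c7) - 96 * c8 * f), ?_⟩
  rw [derivative_sub, hder]
  simp only [derivative_mul, derivative_add, derivative_pow, derivative_X]
  push_cast
  simp only [map_ofNat]
  linear_combination
    X * (c1 * g ^ 7 + 2 * c2 * f * g ^ 6 + 3 * c3 * f ^ 2 * g ^ 5 + 4 * c4 * f ^ 3 * g ^ 4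
      + 5 * c5 * f ^ 4 * g ^ 3 + 6 * c6 * f ^ 5 * g ^ 2 + 7 * c7 * f ^ 6 * g
      + 8 * c8 * f ^ 7) * ((X - 64) * g * hf - f * hg)
    + X * (g ^ 9 * h0 + f * g ^ 8 * h1 + f ^ 2 * g ^ 7 * h2 + f ^ 3 * g ^ 6 * h3
      + f ^ 4 * g ^ 5 * h4 + f ^ 5 * g ^ 4 * h5 + f ^ 6 * g ^ 3 * h6 + f ^ 7 * g ^ 2 * h7)

theorem padeDen_mul_flowForm {K : Type*} [CommRing K] (p : ℕ) (f g : K[X]) :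
    ∃ r, (∑ k ∈ Finset.range 5, padeDen (X - 64 : K[X]) k * f ^ k * g ^ (4 - k))
        * flowForm p f g =
      40320 * (X - 64) ^ 7 * g ^ 8 * stepanovForm p f g + f ^ 9 * r := by
  have n0 := padeNum_eq (X - 64 : K[X]) (k := 0) (by norm_num)
  have n1 := padeNum_eq (X - 64 : K[X]) (k := 1) (by norm_num)
  have n2 := padeNum_eq (X - 64 : K[X]) (k := 2) (by norm_num)
  have n3 := padeNum_eq (X - 64 : K[X]) (k := 3) (by norm_num)
  have n4 := padeNum_eq (X - 64 : K[X]) (k := 4) (by norm_num)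
  have z0 := sum_padeDen_mul_flowCoeff (X - 64 : K[X]) (k := 0) (by norm_num)
  have z1 := sum_padeDen_mul_flowCoeff (X - 64 : K[X]) (k := 1) (by norm_num)
  have z2 := sum_padeDen_mul_flowCoeff (X - 64 : K[X]) (k := 2) (by norm_num)
  have z3 := sum_padeDen_mul_flowCoeff (X - 64 : K[X]) (k := 3) (by norm_num)
  simp only [flowForm, stepanovForm, Finset.sum_range_succ, Finset.sum_range_zero, zero_add]
    at n0 n1 n2 n3 n4 z0 z1 z2 z3 ⊢
  norm_num only at n0 n1 n2 n3 n4 z0 z1 z2 z3 ⊢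
  generalize flowCoeff (X - 64 : K[X]) 0 = c0 at *
  generalize flowCoeff (X - 64 : K[X]) 1 = c1 at *
  generalize flowCoeff (X - 64 : K[X]) 2 = c2 at *
  generalize flowCoeff (X - 64 : K[X]) 3 = c3 at *
  generalize flowCoeff (X - 64 : K[X]) 4 = c4 at *
  generalize flowCoeff (X - 64 : K[X]) 5 = c5 at *
  generalize flowCoeff (X - 64 : K[X]) 6 = c6 at *
  generalize flowCoeff (X - 64 : K[X]) 7 = c7 at *
  generalize flowCoeff (X - 64 : K[X]) 8 = c8 at *
  generalize padeDen (X - 64 : K[X]) 0 = b0 at *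
  generalize padeDen (X - 64 : K[X]) 1 = b1 at *
  generalize padeDen (X - 64 : K[X]) 2 = b2 at *
  generalize padeDen (X - 64 : K[X]) 3 = b3 at *
  generalize padeDen (X - 64 : K[X]) 4 = b4 at *
  refine ⟨X * ((b1 * c8 + b2 * c7 + b3 * c6 + b4 * c5) * g ^ 3
    + (b2 * c8 + b3 * c7 + b4 * c6) * f * g ^ 2
    + (b3 * c8 + b4 * c7) * f ^ 2 * g + b4 * c8 * f ^ 3), ?_⟩
  linear_combination
    X * g ^ 8 * (-(g ^ 4 * n0) - f * g ^ 3 * n1 - f ^ 2 * g ^ 2 * n2 - f ^ 3 * g * n3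
      - f ^ 4 * n4)
    + X * (f ^ 5 * g ^ 7 * z0 + f ^ 6 * g ^ 6 * z1 + f ^ 7 * g ^ 5 * z2 + f ^ 8 * g ^ 4 * z3)

section Vanishing

variable {K : Type*} [Field K] {f g : K[X]} {t : K}

theorem X_sub_C_pow_dvd_of_mul {h q : K[X]} {n : ℕ} (hq : q.eval t ≠ 0)
    (h_dvd : (X - C t) ^ n ∣ q * h) : (X - C t) ^ n ∣ h := by
  refine (IsCoprime.pow_left ?_).dvd_of_dvd_mul_left h_dvd
  refine (Irreducible.coprime_iff_not_dvd (irreducible_X_sub_C t)).2 ?_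
  rwa [dvd_iff_isRoot]

/-- A polynomial that vanishes at `t` and satisfies a first-order linear differential relation
up to order `n` vanishes to order `n + 1`. -/
theorem X_sub_C_pow_succ_dvd_of_derivative {A B T : K[X]} {n : ℕ} (hA : A.eval t ≠ 0)
    (hn : ∀ j, 0 < j → j ≤ n → (j : K) ≠ 0) (hT : T.eval t = 0)
    (h : (X - C t) ^ n ∣ A * derivative T + B * T) : (X - C t) ^ (n + 1) ∣ T := by
  suffices H : ∀ j ≤ n, (X - C t) ^ (j + 1) ∣ T from H n le_rfl
  intro j
  induction j with
  | zero => intro _; simpa [dvd_iff_isRoot] using hT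
  | succ j ih =>
    intro hj
    obtain ⟨S, rfl⟩ := ih (by omega)
    have h1 : (X - C t) ^ j * (X - C t) ∣ (X - C t) ^ j *
        (((j + 1 : ℕ) : K[X]) * A * S + (X - C t) * (A * derivative S + B * S)) := by
      rw [← pow_succ]
      refine ((pow_dvd_pow _ hj).trans h).trans (dvd_of_eq ?_)
      rw [derivative_mul, derivative_X_sub_C_pow]
      simp only [Nat.add_sub_cancel, map_natCast]
      ring
    have h2 := (mul_dvd_mul_iff_left (pow_ne_zero j (X_sub_C_ne_zero t))).1 h1
    have h3 : S.eval t = 0 := by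
      rw [dvd_iff_isRoot, IsRoot.def] at h2
      have := hn (j + 1) (by omega) hj
      push_cast at this
      simpa [hA, this] using h2
    rw [pow_succ]
    exact mul_dvd_mul_left _ (dvd_iff_isRoot.2 h3)

theorem eval_ne_zero_of_system {a : K} {N : ℕ} (hN : ∀ j, 0 < j → j ≤ N → (j : K) ≠ 0)
    (hdeg : f.natDegree < N) (hf0 : f ≠ 0) (hf : X * derivative f = g + C a * f)
    (hg : (X - 64) * (X * derivative g - C a * g) = 12 * f - 64 * g)
    (ht : t ≠ 0) (ht' : t ≠ 64) (hft : f.eval t = 0) : g.eval t ≠ 0 := by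
  intro hgt
  have H : ∀ j ≤ N, (X - C t) ^ j ∣ f ∧ (X - C t) ^ j ∣ g := by
    intro j
    induction j with
    | zero => simp
    | succ j ih =>
      intro hj
      obtain ⟨h1, h2⟩ := ih (by omega)
      constructor
      · refine X_sub_C_pow_succ_dvd_of_derivative (A := X) (B := -C a) (by simpa using ht)
          (fun i hi hij => hN i hi (by omega)) hft ?_
        rwa [show X * derivative f + -C a * f = g by rw [hf]; ring]
      · refine X_sub_C_pow_succ_dvd_of_derivative (A := (X - 64) * X)
          (B := 64 - (X - 64) * C a) ?_ (fun i hi hij => hN i hi (by omega)) hgt ?_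
        · simpa [sub_eq_zero] using ⟨ht', ht⟩
        · rw [show (X - 64) * X * derivative g + (64 - (X - 64) * C a) * g = 12 * f by
            linear_combination hg]
          exact h1.mul_left _
  have := natDegree_le_of_dvd (H N le_rfl).1 hf0
  rw [natDegree_pow, natDegree_X_sub_C] at this
  omega

theorem X_sub_C_pow_nine_dvd_stepanovForm {p : ℕ} [CharP K p] (hp11 : 11 ≤ p)
    {a : K} (hf : X * derivative f = g + C a * f)
    (hg : (X - 64) * (X * derivative g - C a * g) = 12 * f - 64 * g)
    (ht : t ≠ 0) (ht' : t ≠ 64) (htp : t ^ p = t) (hft : f.eval t = 0) (hgt : g.eval t ≠ 0) :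
    (X - C t) ^ 9 ∣ stepanovForm p f g := by
  have hcast : ∀ j, 0 < j → j < p → (j : K) ≠ 0 := fun j hj hjp h =>
    Nat.not_dvd_of_pos_of_lt hj hjp ((CharP.cast_eq_zero_iff K p j).1 h)
  have hfd : (X - C t) ∣ f := dvd_iff_isRoot.2 hft
  have hflow : (X - C t) ^ 9 ∣ flowForm p f g := by
    refine X_sub_C_pow_succ_dvd_of_derivative (A := (X - 64) * X * g)
      (B := -(8 * (X - 64) * X * derivative g) - 7 * X * g) ?_
      (fun j hj hj' => hcast j hj (by omega)) ?_ ?_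
    · simpa [sub_eq_zero] using ⟨⟨ht', ht⟩, hgt⟩
    · simp [flowForm, Finset.sum_range_succ, hft, htp, flowCoeff]
      ring
    · refine ((pow_dvd_pow_of_dvd hfd 8).trans
        (pow_dvd_derivative_flowForm (p := p) hf hg)).trans (dvd_of_eq ?_)
      ring
  obtain ⟨r, hr⟩ := padeDen_mul_flowForm p f g
  refine X_sub_C_pow_dvd_of_mul (q := 40320 * (X - 64) ^ 7 * g ^ 8) ?_ ?_
  · have h40320 : (40320 : K) ≠ 0 := by
      have h2 : (2 : K) ≠ 0 := by exact_mod_cast hcast 2 (by norm_num) (by omega)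
      have h3 : (3 : K) ≠ 0 := by exact_mod_cast hcast 3 (by norm_num) (by omega)
      have h5 : (5 : K) ≠ 0 := by exact_mod_cast hcast 5 (by norm_num) (by omega)
      have h7 : (7 : K) ≠ 0 := by exact_mod_cast hcast 7 (by norm_num) (by omega)
      rw [show (40320 : K) = 2 ^ 7 * 3 ^ 2 * 5 * 7 by norm_num]
      simp [h2, h3, h5, h7]
    simpa [h40320, hgt, sub_eq_zero] using ht'
  · rw [eq_sub_of_add_eq hr.symm]
    exact dvd_sub (hflow.mul_left _) ((pow_dvd_pow_of_dvd hfd 9).mul_right _)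

end Vanishing

theorem natDegree_padeDen_le {K : Type*} [CommRing K] {k : ℕ} (hk : k < 5) :
    (padeDen (X - 64 : K[X]) k).natDegree ≤ 12 := by
  interval_cases k <;> simp only [padeDen] <;> compute_degree

theorem natDegree_padeNum_le {K : Type*} [CommRing K] {k : ℕ} (hk : k < 5) :
    (padeNum (X - 64 : K[X]) k).natDegree ≤ 12 := by
  interval_cases k <;> simp only [padeNum] <;> compute_degree

theorem coeff_padeDen_four {K : Type*} [Field K] :
    (padeDen (X - 64 : K[X]) 4).coeff 12 = 1 := by
  simp only [padeDen]
  compute_degree!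

theorem stepanovForm_natDegree_le_and_ne_zero {K : Type*} [Field K] {f g : K[X]} {p r : ℕ}
    (hp : 2 ≤ p) (hr : f.natDegree = r) (hfm : f.Monic) (hg : g.natDegree < r) :
    (stepanovForm p f g).natDegree ≤ p + 12 + 4 * r ∧ stepanovForm p f g ≠ 0 := by
  have hfk : ∀ k : ℕ, (f ^ k).natDegree ≤ k * r := fun k => hr ▸ natDegree_pow_le
  have hgk : ∀ k : ℕ, (g ^ k).natDegree ≤ k * (r - 1) := fun k =>
    natDegree_pow_le.trans (Nat.mul_le_mul_left _ (by omega))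
  have hterm : ∀ c : K[X], c.natDegree ≤ 12 → ∀ k < 5,
      (c * f ^ k * g ^ (4 - k)).natDegree ≤ 12 + 4 * r - (4 - k) := by
    intro c hc k hk
    refine (natDegree_mul_le_of_le (natDegree_mul_le_of_le hc (hfk k)) (hgk (4 - k))).trans ?_
    interval_cases k <;> omega
  have hA : (X * ∑ k ∈ Finset.range 5,
      padeNum (X - 64 : K[X]) k * f ^ k * g ^ (4 - k)).natDegree ≤ 1 + (12 + 4 * r) :=
    natDegree_mul_le_of_le natDegree_X_le (natDegree_sum_le_of_forall_le _ _ fun k hk =>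
      (hterm _ (natDegree_padeNum_le (Finset.mem_range.1 hk)) k (Finset.mem_range.1 hk)).trans
        (Nat.sub_le _ _))
  have hB : (∑ k ∈ Finset.range 5,
      padeDen (X - 64 : K[X]) k * f ^ k * g ^ (4 - k)).natDegree ≤ 12 + 4 * r :=
    natDegree_sum_le_of_forall_le _ _ fun k hk =>
      (hterm _ (natDegree_padeDen_le (Finset.mem_range.1 hk)) k (Finset.mem_range.1 hk)).trans
        (Nat.sub_le _ _)
  have hBc : (∑ k ∈ Finset.range 5,
      padeDen (X - 64 : K[X]) k * f ^ k * g ^ (4 - k)).coeff (12 + 4 * r) = 1 := by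
    rw [Finset.sum_range_succ, coeff_add, finsetSum_coeff, Finset.sum_eq_zero, zero_add,
      Nat.sub_self, pow_zero, mul_one, coeff_mul_add_eq_of_natDegree_le (natDegree_padeDen_le (by norm_num))
        (hfk 4), coeff_padeDen_four, one_mul]
    · have := (hfm.pow 4).coeff_natDegree
      rwa [hfm.natDegree_pow, hr] at this
    · intro k hk
      have hk := Finset.mem_range.1 hk
      refine coeff_eq_zero_of_natDegree_lt
        ((hterm _ (natDegree_padeDen_le (by omega)) k (by omega)).trans_lt (by omega))
  have hcoeff : (stepanovForm p f g).coeff (p + (12 + 4 * r)) = -1 := by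
    rw [stepanovForm, coeff_sub, coeff_X_pow_mul', if_pos (by omega), Nat.add_sub_cancel_left, hBc,
      coeff_eq_zero_of_natDegree_lt (hA.trans_lt (by omega)), zero_sub]
  constructor
  · rw [add_assoc]
    exact (natDegree_sub_le _ _).trans
      (max_le (hA.trans (by omega)) (natDegree_mul_le_of_le (natDegree_X_pow_le p) hB))
  · intro h0
    rw [h0, coeff_zero] at hcoeff
    exact one_ne_zero (neg_eq_zero.1 hcoeff.symm)

/-- Stepanov bound for the number of zeros of a monic polynomial solution of the hypergeometric
system among the points fixed by Frobenius other than the singular ones. -/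
theorem nine_mul_card_le {K : Type*} [Field K] {f g : K[X]} {p r : ℕ} [CharP K p]
    (hp11 : 11 ≤ p) (hr : f.natDegree = r) (hfm : f.Monic) (hgr : g.natDegree < r)
    (hrp : r + 1 < p) {a : K} (hf : X * derivative f = g + C a * f)
    (hg : (X - 64) * (X * derivative g - C a * g) = 12 * f - 64 * g) (S : Finset K)
    (hS : ∀ t ∈ S, t ≠ 0 ∧ t ≠ 64 ∧ t ^ p = t ∧ f.eval t = 0) :
    9 * S.card ≤ p + 12 + 4 * r := by
  obtain ⟨hdeg, hne⟩ := stepanovForm_natDegree_le_and_ne_zero (p := p) (by omega) hr hfm hgr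
  have hN : ∀ j, 0 < j → j ≤ r + 1 → (j : K) ≠ 0 := fun j hj hjp h =>
    Nat.not_dvd_of_pos_of_lt hj (by omega) ((CharP.cast_eq_zero_iff K p j).1 h)
  have hdvd : ∏ t ∈ S, (X - C t) ^ 9 ∣ stepanovForm p f g := by
    refine Finset.prod_dvd_of_coprime ?_ ?_
    · intro t _ s _ hts
      exact (isCoprime_X_sub_C_of_isUnit_sub (sub_ne_zero.2 hts).isUnit).pow
    · intro t ht
      obtain ⟨h1, h2, h3, h4⟩ := hS t ht
      exact X_sub_C_pow_nine_dvd_stepanovForm hp11 hf hg h1 h2 h3 h4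
        (eval_ne_zero_of_system hN (by omega) hfm.ne_zero hf hg h1 h2 h4)
  have := (natDegree_le_of_dvd hdvd hne).trans hdeg
  rw [natDegree_prod _ _ fun t _ => pow_ne_zero _ (X_sub_C_ne_zero t)] at this
  simpa [natDegree_pow, mul_comm] using this

section HypergeometricSum

variable {K : Type*} [Field K] {c : ℕ → K} {m r : ℕ}

theorem natDegree_and_monic_sum_C_mul_X_pow_sub (h0 : c 0 = 1) (hmr : m ≤ r) :
    (∑ n ∈ Finset.range (m + 1), C (c n) * X ^ (r - n)).natDegree = r ∧
      (∑ n ∈ Finset.range (m + 1), C (c n) * X ^ (r - n)).Monic := by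
  have hle : (∑ n ∈ Finset.range (m + 1), C (c n) * X ^ (r - n)).natDegree ≤ r :=
    natDegree_sum_le_of_forall_le _ _ fun n _ =>
      (natDegree_C_mul_X_pow_le _ _).trans (Nat.sub_le _ _)
  have hcoeff : (∑ n ∈ Finset.range (m + 1), C (c n) * X ^ (r - n)).coeff r = 1 := by
    rw [finsetSum_coeff, Finset.sum_eq_single 0]
    · simp [h0]
    · intro n hn hn0
      have := Finset.mem_range.1 hn
      rw [coeff_C_mul_X_pow, if_neg (by omega)]
    · simp
  exact ⟨natDegree_eq_of_le_of_coeff_ne_zero hle (by simp [hcoeff]),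
    monic_of_natDegree_le_of_coeff_eq_one r hle hcoeff⟩

theorem X_mul_derivative_sum_C_mul_X_pow_sub (hmr : m ≤ r) :
    X * derivative (∑ n ∈ Finset.range (m + 1), C (c n) * X ^ (r - n)) =
      ∑ n ∈ Finset.range (m + 1), C (-(n : K) * c n) * X ^ (r - n)
        + C (r : K) * ∑ n ∈ Finset.range (m + 1), C (c n) * X ^ (r - n) := by
  rw [derivative_sum, Finset.mul_sum, Finset.mul_sum, ← Finset.sum_add_distrib]
  refine Finset.sum_congr rfl fun n hn => ?_
  have hn := Finset.mem_range.1 hn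
  have hX : (X : K[X]) * (C (c n * ((r - n : ℕ) : K)) * X ^ (r - n - 1)) =
      C (c n * ((r - n : ℕ) : K)) * X ^ (r - n) := by
    rcases Nat.eq_zero_or_pos (r - n) with h | h
    · simp [h]
    · obtain ⟨k, hk⟩ := Nat.exists_eq_add_of_lt h
      rw [hk, show 0 + k + 1 - 1 = k by omega]
      ring
  rw [derivative_C_mul_X_pow, hX, Nat.cast_sub (by omega)]
  simp only [C_mul, C_sub, C_neg]
  ring

theorem natDegree_sum_C_neg_mul_X_pow_sub_lt (hr : 0 < r) :
    (∑ n ∈ Finset.range (m + 1), C (-(n : K) * c n) * X ^ (r - n)).natDegree < r := by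
  rw [Finset.sum_range_succ']
  simp only [Nat.cast_zero, neg_zero, zero_mul, C_0, add_zero]
  exact (natDegree_sum_le_of_forall_le (n := r - 1) _ _ fun n _ =>
    (natDegree_C_mul_X_pow_le _ _).trans (by omega)).trans_lt (by omega)

theorem hypergeometric_system (hmr : m ≤ r)
    (hrec : ∀ n ≤ m, ((n : K) + 1) ^ 2 * c (n + 1) = 4 * (4 * n + 1) * (4 * n + 3) * c n)
    (hlast : c (m + 1) = 0) :
    (X - 64) * (X * derivative (∑ n ∈ Finset.range (m + 1), C (-(n : K) * c n) * X ^ (r - n))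
        - C (r : K) * ∑ n ∈ Finset.range (m + 1), C (-(n : K) * c n) * X ^ (r - n)) =
      12 * ∑ n ∈ Finset.range (m + 1), C (c n) * X ^ (r - n)
        - 64 * ∑ n ∈ Finset.range (m + 1), C (-(n : K) * c n) * X ^ (r - n) := by
  have shift : ∀ N ≤ m, X * ∑ n ∈ Finset.range (N + 1), C ((n : K) ^ 2 * c n) * X ^ (r - n) =
      ∑ n ∈ Finset.range N, C (((n : K) + 1) ^ 2 * c (n + 1)) * X ^ (r - n) := by
    intro N hN
    rw [Finset.sum_range_succ', mul_add, Finset.mul_sum]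
    simp only [Nat.cast_zero, zero_pow two_ne_zero, zero_mul, C_0, mul_zero, add_zero]
    refine Finset.sum_congr rfl fun n hn => ?_
    have hn := Finset.mem_range.1 hn
    rw [show r - n = r - (n + 1) + 1 by omega]
    push_cast
    ring
  have hzero : C (4 * (4 * (m : K) + 1) * (4 * m + 3) * c m) = 0 := by
    rw [← hrec m le_rfl, hlast, mul_zero, C_0]
  have hsum : X * ∑ n ∈ Finset.range (m + 1), C ((n : K) ^ 2 * c n) * X ^ (r - n) =
      ∑ n ∈ Finset.range (m + 1),
        C (4 * (4 * (n : K) + 1) * (4 * n + 3) * c n) * X ^ (r - n) := by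
    rw [shift m le_rfl, Finset.sum_range_succ _ m, hzero, zero_mul, add_zero]
    refine Finset.sum_congr rfl fun n hn => ?_
    rw [hrec n (Finset.mem_range.1 hn).le]
  rw [X_mul_derivative_sum_C_mul_X_pow_sub hmr, add_sub_cancel_right]
  have hsq : ∑ n ∈ Finset.range (m + 1), C (-(n : K) * (-(n : K) * c n)) * X ^ (r - n) =
      ∑ n ∈ Finset.range (m + 1), C ((n : K) ^ 2 * c n) * X ^ (r - n) :=
    Finset.sum_congr rfl fun n _ => by ring_nf
  rw [hsq, sub_mul, hsum, Finset.mul_sum, Finset.mul_sum, Finset.mul_sum,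
    ← Finset.sum_sub_distrib, ← Finset.sum_sub_distrib]
  refine Finset.sum_congr rfl fun n _ => ?_
  simp only [C_mul, C_add, C_neg, C_pow, C_1, map_ofNat]
  ring

end HypergeometricSum

theorem eps_eq (hp : 5 ≤ p) : eps p = p % 4 / 2 := by
  have hp2 : p ≠ 2 := by omega
  have hodd := (Fact.out : p.Prime).eq_two_or_odd.resolve_left hp2
  rw [eps, legendreSym.at_neg_one hp2]
  rcases (by omega : p % 4 = 1 ∨ p % 4 = 3) with h | h
  · rw [ZMod.χ₄_nat_one_mod_four h, h]; rfl
  · rw [ZMod.χ₄_nat_three_mod_four h, h]; rfl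

/-- The coefficient of `X ^ (p / 4 + eps p - n)` in `ss2Poly p`. -/
def ss2Coeff (n : ℕ) : ZMod p :=
  poch p (-(p / 4 : ℕ) : ZMod p) n * poch p ((3 : ZMod p) / 4 - (eps p : ZMod p) / 2) n /
    ((n.factorial : ZMod p)) ^ 2 * 64 ^ n

theorem ss2Coeff_zero : ss2Coeff p 0 = 1 := by simp [ss2Coeff, poch]

theorem natCast_ne_zero_of_pos_of_lt {n : ℕ} (h0 : 0 < n) (hn : n < p) : (n : ZMod p) ≠ 0 :=
  fun h => Nat.not_dvd_of_pos_of_lt h0 hn ((ZMod.natCast_eq_zero_iff n p).1 h)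

theorem ss2Coeff_succ (hp : 5 ≤ p) {n : ℕ} (hn : n + 1 < p) :
    ((n : ZMod p) + 1) ^ 2 * ss2Coeff p (n + 1) =
      4 * (4 * n + 1) * (4 * n + 3) * ss2Coeff p n := by
  have h2 : (2 : ZMod p) ≠ 0 := by
    exact_mod_cast natCast_ne_zero_of_pos_of_lt p (n := 2) (by norm_num) (by omega)
  have h4 : (4 : ZMod p) ≠ 0 := by
    exact_mod_cast natCast_ne_zero_of_pos_of_lt p (n := 4) (by norm_num) (by omega)
  have hn1 : (n : ZMod p) + 1 ≠ 0 := by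
    exact_mod_cast natCast_ne_zero_of_pos_of_lt p n.succ_pos hn
  have hfac : (n.factorial : ZMod p) ≠ 0 := by
    rw [Ne, ZMod.natCast_eq_zero_iff, (Fact.out : p.Prime).dvd_factorial]
    omega
  have hodd := (Fact.out : p.Prime).eq_two_or_odd.resolve_left (by omega)
  have key : 64 * ((-(p / 4 : ℕ) : ZMod p) + n) *
      ((3 : ZMod p) / 4 - (eps p : ZMod p) / 2 + n) = 4 * (4 * n + 1) * (4 * n + 3) := by
    have hcast : 4 * ((p / 4 : ℕ) : ZMod p) + ((p % 4 : ℕ) : ZMod p) = 0 := by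
      rw [← ZMod.natCast_self p]
      exact_mod_cast congrArg (Nat.cast (R := ZMod p)) (Nat.div_add_mod p 4)
    rw [eps_eq p hp]
    generalize ((p / 4 : ℕ) : ZMod p) = m at hcast ⊢
    rcases (by omega : p % 4 = 1 ∨ p % 4 = 3) with h | h <;> rw [h] at hcast ⊢ <;>
      norm_num at hcast ⊢ <;> field_simp
    · linear_combination -(16 * (3 + 4 * (n : ZMod p))) * hcast
    · linear_combination -(32 * (1 + 4 * (n : ZMod p))) * hcast
  simp only [ss2Coeff, poch, ascPochhammer_succ_eval, Nat.factorial_succ] at key ⊢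
  push_cast
  rw [← key]
  field_simp
  ring

theorem ss2Coeff_div_four_add_one : ss2Coeff p (p / 4 + 1) = 0 := by
  simp [ss2Coeff, poch, ascPochhammer_succ_eval]

theorem div_four_add_eps (hp : 5 ≤ p) : p / 4 + eps p = (p + 1) / 4 := by
  have := (Fact.out : p.Prime).eq_two_or_odd
  rw [eps_eq p hp]
  omega

theorem ss2Poly_natDegree_and_monic (hp : 5 ≤ p) :
    (ss2Poly p).natDegree = (p + 1) / 4 ∧ (ss2Poly p).Monic := by
  rw [← div_four_add_eps p hp]
  exact natDegree_and_monic_sum_C_mul_X_pow_sub (ss2Coeff_zero p) (Nat.le_add_right _ _)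

theorem nine_mul_L2_le (hp : 11 ≤ p) : 9 * L2 p ≤ p + 30 + 4 * ((p + 1) / 4) := by
  have hdeg := ss2Poly_natDegree_and_monic p (by omega)
  have hcard := nine_mul_card_le hp hdeg.1 hdeg.2
    (natDegree_sum_C_neg_mul_X_pow_sub_lt (m := p / 4) (c := ss2Coeff p) (by omega))
    (by omega)
    (by
      rw [← div_four_add_eps p (by omega)]
      exact X_mul_derivative_sum_C_mul_X_pow_sub (Nat.le_add_right _ _))
    (by
      rw [← div_four_add_eps p (by omega)]
      exact hypergeometric_system (Nat.le_add_right _ _)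
        (fun n hn => ss2Coeff_succ p (by omega) (by omega)) (ss2Coeff_div_four_add_one p))
    ((ss2Poly p).roots.toFinset \ {0, 64}) (fun t ht => by
      simp only [Finset.mem_sdiff, Multiset.mem_toFinset, Finset.mem_insert,
        Finset.mem_singleton, not_or, mem_roots hdeg.2.ne_zero] at ht
      exact ⟨ht.2.1, ht.2.2, ZMod.pow_card t, ht.1⟩)
  have hle := Finset.le_card_sdiff {0, (64 : ZMod p)} (ss2Poly p).roots.toFinset
  have := Finset.card_le_two (a := (0 : ZMod p)) (b := 64)
  rw [L2]
  omega

/-- The residue modulo `q` of `(n !) ^ 2` times the `n`-th coefficient of `ss2Poly q`. -/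
def hyperCoeff (q : ℕ) : ℕ → ℕ
  | 0 => 1
  | n + 1 => hyperCoeff q n * (4 * (4 * n + 1) * (4 * n + 3)) % q

/-- The residue modulo `q` of `(n !) ^ 2` times the value at `t` of the polynomial formed by the
first `n + 1` coefficients of `ss2Poly q`, computed by Horner's rule. -/
def hyperEval (q t : ℕ) : ℕ → ℕ
  | 0 => 1
  | n + 1 => (t * (n + 1) ^ 2 * hyperEval q t n + hyperCoeff q (n + 1)) % q

/-- The number of roots of `ss2Poly q` among the residues modulo `q`, in computable form. -/
def rootCount (q : ℕ) : ℕ :=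
  Nat.count (fun t => t ^ (q % 4 / 2) * hyperEval q t (q / 4) % q = 0) q

theorem cast_hyperCoeff (hp : 5 ≤ p) {n : ℕ} (hn : n < p) :
    (hyperCoeff p n : ZMod p) = (n.factorial : ZMod p) ^ 2 * ss2Coeff p n := by
  induction n with
  | zero => simp [hyperCoeff, ss2Coeff_zero]
  | succ n ih =>
    rw [hyperCoeff, ZMod.natCast_mod, Nat.factorial_succ]
    push_cast
    rw [ih (by omega)]
    linear_combination -(n.factorial : ZMod p) ^ 2 * ss2Coeff_succ p hp hn

theorem cast_hyperEval (hp : 5 ≤ p) (t : ℕ) {n : ℕ} (hn : n < p) :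
    (hyperEval p t n : ZMod p) = (n.factorial : ZMod p) ^ 2 *
      ∑ i ∈ Finset.range (n + 1), ss2Coeff p i * (t : ZMod p) ^ (n - i) := by
  induction n with
  | zero => simp [hyperEval, ss2Coeff_zero]
  | succ n ih =>
    have hsum : ∑ i ∈ Finset.range (n + 1), ss2Coeff p i * (t : ZMod p) ^ (n + 1 - i) =
        t * ∑ i ∈ Finset.range (n + 1), ss2Coeff p i * (t : ZMod p) ^ (n - i) := by
      rw [Finset.mul_sum]
      refine Finset.sum_congr rfl fun i hi => ?_
      rw [Nat.sub_add_comm (Finset.mem_range_succ_iff.1 hi), pow_succ]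
      ring
    rw [hyperEval, ZMod.natCast_mod, Finset.sum_range_succ _ (n + 1), hsum]
    push_cast
    rw [ih (by omega), cast_hyperCoeff p hp hn, Nat.factorial_succ, Nat.sub_self, pow_zero]
    push_cast
    ring

theorem eval_ss2Poly_eq_zero_iff (hp : 5 ≤ p) (t : ℕ) :
    (ss2Poly p).eval (t : ZMod p) = 0 ↔ t ^ (p % 4 / 2) * hyperEval p t (p / 4) % p = 0 := by
  have hfac : ((p / 4).factorial : ZMod p) ≠ 0 := by
    rw [Ne, ZMod.natCast_eq_zero_iff, (Fact.out : p.Prime).dvd_factorial]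
    omega
  have heval : (ss2Poly p).eval (t : ZMod p) = (t : ZMod p) ^ (p % 4 / 2) *
      ∑ i ∈ Finset.range (p / 4 + 1), ss2Coeff p i * (t : ZMod p) ^ (p / 4 - i) := by
    rw [ss2Poly, eval_finsetSum, Finset.mul_sum, eps_eq p hp]
    refine Finset.sum_congr rfl fun i hi => ?_
    rw [Nat.sub_add_comm (Finset.mem_range_succ_iff.1 hi), eval_mul, eval_C, eval_pow, eval_X, pow_add, ss2Coeff,
      eps_eq p hp]
    ring
  rw [← Nat.dvd_iff_mod_eq_zero, ← ZMod.natCast_eq_zero_iff, Nat.cast_mul, Nat.cast_pow,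
    cast_hyperEval p hp t (by omega), heval, mul_eq_zero, mul_eq_zero, mul_eq_zero]
  simp [hfac]

theorem L2_eq_rootCount (hp : 5 ≤ p) : L2 p = rootCount p := by
  have hne := (ss2Poly_natDegree_and_monic p hp).2.ne_zero
  rw [L2, rootCount, Nat.count_eq_card_filter_range]
  symm
  refine Finset.card_bij (fun t _ => (t : ZMod p)) ?_ ?_ ?_
  · intro t ht
    rw [Multiset.mem_toFinset, mem_roots hne]
    exact (eval_ss2Poly_eq_zero_iff p hp t).2 (Finset.mem_filter.1 ht).2
  · intro s hs t ht hst
    have hs := Finset.mem_range.1 (Finset.mem_filter.1 hs).1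
    have ht := Finset.mem_range.1 (Finset.mem_filter.1 ht).1
    have := (ZMod.natCast_eq_natCast_iff' s t p).1 hst
    rwa [Nat.mod_eq_of_lt hs, Nat.mod_eq_of_lt ht] at this
  · intro x hx
    rw [Multiset.mem_toFinset, mem_roots hne] at hx
    refine ⟨x.val, Finset.mem_filter.2 ⟨Finset.mem_range.2 (ZMod.val_lt x), ?_⟩,
      ZMod.natCast_zmod_val x⟩
    rw [← eval_ss2Poly_eq_zero_iff p hp, ZMod.natCast_zmod_val]
    exact hx

set_option maxRecDepth 100000 in
/-- The bounds for all `q < 342`; the coprimality conditions cut out the primes. -/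
theorem rootCount_bound_iff_of_lt : ∀ q ∈ List.range 342, 5 ≤ q →
    (q ≤ 17 ∧ Nat.gcd q 6 = 1 ∨ Nat.gcd q 510510 = 1) →
    ((q + 1) / 4 - rootCount q ≤ 2 ↔ q ∣ babyMonsterOrder) ∧
      ((q + 1) / 4 - rootCount q ≤ 6 ↔ q ∣ monsterOrder) := by
  decide +kernel

theorem le_of_prime_dvd_monsterOrder {q : ℕ} (hq : q.Prime) (h : q ∣ monsterOrder) : q ≤ 71 := by
  have hdvd : q ∣ Nat.factorial 71 ^ 46 := h.trans (by decide +kernel)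
  exact (hq.dvd_factorial).1 (hq.dvd_of_dvd_pow hdvd)

theorem babyMonsterOrder_dvd_monsterOrder : babyMonsterOrder ∣ monsterOrder := by
  decide +kernel

/-- For every prime p ≥ 5: deg ss_p^{(2)} − L^{(2)}(p) ≤ 2 iff p divides the order of the
Baby monster group, and deg ss_p^{(2)} − L^{(2)}(p) ≤ 6 iff p divides the order of the
Monster group. -/
theorem ss2_quadratic_factor_bound_iff (hp : 5 ≤ p) :
    ((ss2Poly p).natDegree - L2 p ≤ 2 ↔ p ∣ babyMonsterOrder)
      ∧ ((ss2Poly p).natDegree - L2 p ≤ 6 ↔ p ∣ monsterOrder) := by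
  have hprime : p.Prime := Fact.out
  rw [(ss2Poly_natDegree_and_monic p hp).1]
  rcases lt_or_ge p 342 with hlt | hge
  · rw [L2_eq_rootCount p hp]
    refine rootCount_bound_iff_of_lt p (List.mem_range.2 hlt) hp ?_
    rcases le_or_gt p 17 with h17 | h17
    · refine Or.inl ⟨h17, (hprime.coprime_iff_not_dvd).2 fun h => ?_⟩
      exact absurd (hprime.dvd_factorial.1 (show p ∣ Nat.factorial 3 from h)) (by omega)
    · refine Or.inr ((hprime.coprime_iff_not_dvd).2 fun h => ?_)
      have hdvd : p ∣ Nat.factorial 17 := h.trans (by decide +kernel)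
      exact absurd (hprime.dvd_factorial.1 hdvd) (by omega)
  · have hodd := hprime.eq_two_or_odd
    have hbound := nine_mul_L2_le p (by omega)
    have hmonster : ¬ p ∣ monsterOrder := fun h => by
      have := le_of_prime_dvd_monsterOrder hprime h
      omega
    exact ⟨iff_of_false (by omega) fun h =>
      hmonster (h.trans babyMonsterOrder_dvd_monsterOrder), iff_of_false (by omega) hmonster⟩
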